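/- arXiv:2509.18070 — 2 statements merged into one kernel-verified Lean document; each statement's English description precedes it below -/
import Mathlib

section
/- Let ε ≠ 0 and ℳ_{ν,ε} : H²(𝕋) → L²(𝕋). Then σ_{L²}(ℳ_{ν,ε}) = ν·σ_{L²}(𝒟_ε) = {−ν(j² + ε²) : j ∈ ℤ}. Moreover the family of eigenfunctions {U(y) − iεν} ∪ {e^{ijy}, e^{−ijy} : j ∈ ℕ}, associated respectively with the eigenvalues −νε² and −ν(j² + ε²), is a basis of L²(𝕋). -/
open Complex
open scoped ComplexConjugate

noncomputable section

/-- Fourier-side model of a function on `𝕋 = ℝ/2πℤ`: `c j` is the `j`-th Fourier coefficient. -/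
abbrev FC : Type := ℤ → ℂ

/-- membership in `L²(𝕋)` -/
def memL2 (c : FC) : Prop := Summable fun j : ℤ => ‖c j‖ ^ 2

/-- membership in the Sobolev space `H^s(𝕋)` -/
def memHs (s : ℝ) (c : FC) : Prop :=
  Summable fun j : ℤ => (1 + (j : ℝ) ^ 2) ^ s * ‖c j‖ ^ 2

/-- squared `L²(𝕋)` norm: `∫_𝕋 |f|² = 2π ∑ |f_j|²` -/
def L2normSq (c : FC) : ℝ := (2 * Real.pi) * ∑' j : ℤ, ‖c j‖ ^ 2

def L2norm (c : FC) : ℝ := Real.sqrt (L2normSq c)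

/-- the `H^s(𝕋)` Sobolev norm -/
def HsNorm (s : ℝ) (c : FC) : ℝ :=
  Real.sqrt ((2 * Real.pi) * ∑' j : ℤ, (1 + (j : ℝ) ^ 2) ^ s * ‖c j‖ ^ 2)

/-- `L²(𝕋)` inner product `⟨f,g⟩ = ∫_𝕋 f ḡ = 2π ∑ f_j ḡ_j` (linear in the first entry) -/
def L2inner (f g : FC) : ℂ := (2 * Real.pi) * ∑' j : ℤ, f j * conj (g j)

/-- pointwise product of two functions, i.e. convolution of Fourier coefficients -/
def fmul (U c : FC) : FC := fun j => ∑' k : ℤ, U (j - k) * c k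

/-- Fourier coefficients of the second derivative `U''` -/
def dd (U : FC) : FC := fun j => -(j : ℂ) ^ 2 * U j

/-- the zero-average primitive `∂_y⁻¹U` -/
def invDer (U : FC) : FC := fun j => if j = 0 then 0 else U j / (Complex.I * (j : ℂ))

/-- the average projection `Π₀` -/
def Pi0 (c : FC) : FC := fun j => if j = 0 then c 0 else 0

/-- `Π_≠ = Id - Π₀` -/
def PiNe (c : FC) : FC := fun j => if j = 0 then 0 else c j

/-- `𝒟_ε = ∂_yy - ε²` -/
def Dop (ε : ℝ) (c : FC) : FC := fun j => -((((j : ℝ) ^ 2 + ε ^ 2 : ℝ)) : ℂ) * c j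

/-- `(-∂_yy + ε²)⁻¹` -/
def invD (ε : ℝ) (c : FC) : FC := fun j => (((1 / ((j : ℝ) ^ 2 + ε ^ 2) : ℝ)) : ℂ) * c j

/-- the Rayleigh-type operator `ℛ_ε = U + U''(-∂_yy + ε²)⁻¹ Π_≠` -/
def Rop (ε : ℝ) (U c : FC) : FC := fun j => fmul U c j + fmul (dd U) (invD ε (PiNe c)) j

/-- the leading operator `ℳ_{ν,ε} = ν𝒟_ε - (i/ε) U'' Π₀` -/
def Mop (ν ε : ℝ) (U c : FC) : FC :=
  fun j => (ν : ℂ) * Dop ε c j - Complex.I / (ε : ℂ) * c 0 * dd U j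

/-- the full linearized operator `ℒ_{ν,ε} = ℳ_{ν,ε} - iεℛ_ε` -/
def Lop (ν ε : ℝ) (U c : FC) : FC :=
  fun j => Mop ν ε U c j - Complex.I * (ε : ℂ) * Rop ε U c j

/-- conjugate-symmetry of the Fourier coefficients, i.e. `U` is real valued -/
def realSymm (U : FC) : Prop := ∀ j : ℤ, U (-j) = conj (U j)

/-- the Fourier coefficients of a (real-valued) function on `𝕋 = ℝ/2πℤ` -/
def fCoeff (U : ℝ → ℝ) : FC := fun j =>
  (1 / (2 * Real.pi)) * ∫ y in (0:ℝ)..(2 * Real.pi),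
    Complex.exp (-(Complex.I * (j : ℂ) * (y : ℂ))) * (U y : ℂ)

/-- Fourier coefficients of the eigenfunction `U(y) - iεν`. -/
def eig0 (U : ℝ → ℝ) (ν ε : ℝ) : FC :=
  fun j => fCoeff U j - (if j = 0 then Complex.I * ε * ν else 0)

/-- Fourier coefficients of `e^{ijy}`. -/
def expFn (j : ℤ) : FC := fun m => if m = j then 1 else 0

theorem memL2.of_isBigO {c d : FC} (hd : memL2 d) (h : c =O[Filter.cofinite] d) : memL2 c :=
  summable_of_isBigO hd (h.norm_norm.pow 2)

theorem memL2.sub {c d : FC} (hc : memL2 c) (hd : memL2 d) : memL2 (fun j => c j - d j) := by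
  refine Summable.of_nonneg_of_le (fun _ => sq_nonneg _) (fun j => ?_)
    ((hc.mul_left 2).add (hd.mul_left 2))
  have h := pow_le_pow_left₀ (norm_nonneg _) (norm_sub_le (c j) (d j)) 2
  nlinarith [sq_nonneg (‖c j‖ - ‖d j‖)]

theorem memL2.const_mul {c : FC} (hc : memL2 c) (a : ℂ) : memL2 (fun j => a * c j) :=
  hc.of_isBigO (Asymptotics.isBigO_const_mul_self a c _)

theorem memHs_two_iff {c : FC} : memHs 2 c ↔ memL2 (fun j => (1 + (j : ℂ) ^ 2) * c j) := by
  unfold memHs memL2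
  refine summable_congr fun j => ?_
  have h : ‖(1 + (j : ℂ) ^ 2)‖ = 1 + (j : ℝ) ^ 2 := by
    have : (1 + (j : ℂ) ^ 2) = ((1 + (j : ℝ) ^ 2 : ℝ) : ℂ) := by push_cast; rfl
    rw [this, Complex.norm_real, Real.norm_of_nonneg (by positivity)]
  rw [norm_mul, mul_pow, h, Real.rpow_ofNat]

theorem tendsto_intCast_sq_cofinite :
    Filter.Tendsto (fun j : ℤ => (j : ℝ) ^ 2) Filter.cofinite Filter.atTop := by
  have h := (Filter.tendsto_pow_atTop two_ne_zero).comp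
    ((tendsto_norm_cocompact_atTop (E := ℝ)).comp Int.tendsto_coe_cofinite)
  exact h.congr fun j => by simp

/-- The symbol of `ν𝒟_ε - z` is elliptic of order two. -/
theorem isBigO_symbol {ν : ℝ} (hν : 0 < ν) (ε : ℝ) (z : ℂ) :
    (fun j : ℤ => 1 + (j : ℂ) ^ 2) =O[Filter.cofinite]
      fun j : ℤ => -((ν * ((j : ℝ) ^ 2 + ε ^ 2) : ℝ) : ℂ) - z := by
  refine Asymptotics.IsBigO.of_bound (4 / ν) ?_
  filter_upwards [tendsto_intCast_sq_cofinite.eventually_ge_atTop (2 * ‖z‖ / ν + 1)] with j hj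
  have h0 : 0 ≤ 2 * ‖z‖ / ν := by positivity
  have hz : 2 * ‖z‖ ≤ ν * (j : ℝ) ^ 2 := by
    have := mul_le_mul_of_nonneg_left hj hν.le
    have e : ν * (2 * ‖z‖ / ν + 1) = 2 * ‖z‖ + ν := by field_simp
    linarith
  have hlow := norm_sub_norm_le (-((ν * ((j : ℝ) ^ 2 + ε ^ 2) : ℝ) : ℂ)) z
  rw [norm_neg, Complex.norm_real, Real.norm_of_nonneg (by positivity)] at hlow
  have hup : ‖(1 + (j : ℂ) ^ 2)‖ ≤ 1 + (j : ℝ) ^ 2 := by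
    refine (norm_add_le _ _).trans ?_
    simp
  refine hup.trans ?_
  rw [div_mul_eq_mul_div, le_div_iff₀ hν]
  nlinarith [mul_nonneg hν.le (sq_nonneg ε)]

theorem fCoeff_eq_fourierCoeffOn (U : ℝ → ℝ) (j : ℤ) :
    fCoeff U j = fourierCoeffOn Real.two_pi_pos (fun y => (U y : ℂ)) j := by
  rw [fourierCoeffOn_eq_integral, fCoeff, sub_zero, Complex.real_smul]
  push_cast
  congr 1
  refine intervalIntegral.integral_congr fun y _ => ?_
  simp only [fourier_coe_apply, smul_eq_mul]
  congr 2
  have : (Real.pi : ℂ) ≠ 0 := by exact_mod_cast Real.pi_ne_zero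
  push_cast
  field_simp

theorem memL2_fCoeff {U : ℝ → ℝ} (hU : Continuous U) : memL2 (fCoeff U) := by
  have hc : Continuous fun y => (U y : ℂ) := Complex.continuous_ofReal.comp hU
  have hm : MeasureTheory.MemLp (fun y => (U y : ℂ)) 2
      (MeasureTheory.volume.restrict (Set.Ioc 0 (2 * Real.pi))) := by
    obtain ⟨C, hC⟩ := isCompact_Icc.exists_bound_of_continuousOn
      (hc.continuousOn (s := Set.Icc 0 (2 * Real.pi)))
    refine MeasureTheory.MemLp.of_bound hc.aestronglyMeasurable C ?_
    filter_upwards [MeasureTheory.ae_restrict_mem measurableSet_Ioc] with y hy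
    exact hC y (Set.Ioc_subset_Icc_self hy)
  simpa only [memL2, fCoeff_eq_fourierCoeffOn] using
    (hasSum_sq_fourierCoeffOn Real.two_pi_pos hm).summable

theorem fCoeff_deriv {U : ℝ → ℝ} (hU : ContDiff ℝ 1 U)
    (hper : Function.Periodic U (2 * Real.pi)) {j : ℤ} (hj : j ≠ 0) :
    fCoeff (deriv U) j = Complex.I * j * fCoeff U j := by
  have hd : ∀ x, HasDerivAt (fun y => (U y : ℂ)) ((deriv U x : ℝ) : ℂ) x := fun x =>
    ((hU.differentiable one_ne_zero) x).hasDerivAt.ofReal_comp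
  have hc : Continuous fun y => ((deriv U y : ℝ) : ℂ) :=
    Complex.continuous_ofReal.comp (hU.continuous_deriv le_rfl)
  have h := fourierCoeffOn_of_hasDerivAt Real.two_pi_pos hj (fun x _ => hd x)
    (hc.intervalIntegrable _ _)
  have hend : U (2 * Real.pi) = U 0 := by simpa using hper 0
  rw [← fCoeff_eq_fourierCoeffOn, ← fCoeff_eq_fourierCoeffOn, hend] at h
  have hpi : (Real.pi : ℂ) ≠ 0 := by exact_mod_cast Real.pi_ne_zero
  have hj' : (j : ℂ) ≠ 0 := by exact_mod_cast hj
  rw [h]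
  push_cast
  field_simp [Complex.I_ne_zero]
  ring

theorem memL2_sq_mul_fCoeff {U : ℝ → ℝ} (hU : ContDiff ℝ 2 U)
    (hper : Function.Periodic U (2 * Real.pi)) : memL2 (fun j => (j : ℂ) ^ 2 * fCoeff U j) := by
  have hU' : ContDiff ℝ 1 (deriv U) := (contDiff_succ_iff_deriv (n := 1).1 hU).2.2
  have hper' : Function.Periodic (deriv U) (2 * Real.pi) := fun x => by
    rw [← deriv_comp_add_const]
    exact congrArg (deriv · x) (funext hper)
  refine (memL2_fCoeff (hU'.continuous_deriv le_rfl)).of_isBigO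
    (Asymptotics.IsBigO.of_bound 1 (Filter.Eventually.of_forall fun j => ?_))
  rcases eq_or_ne j 0 with rfl | hj
  · simp
  · rw [fCoeff_deriv hU' hper' hj, fCoeff_deriv (hU.of_le one_le_two) hper hj]
    simp [pow_two, mul_assoc]

theorem memHs_two_fCoeff {U : ℝ → ℝ} (hU : ContDiff ℝ 2 U)
    (hper : Function.Periodic U (2 * Real.pi)) : memHs 2 (fCoeff U) := by
  refine memHs_two_iff.2 (((memL2_fCoeff hU.continuous).sub
    ((memL2_sq_mul_fCoeff hU hper).const_mul (-1))).congr fun j => ?_)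
  congr 2
  ring

theorem fCoeff_zero {U : ℝ → ℝ} (havg : (∫ y in (0:ℝ)..(2 * Real.pi), U y) = 0) :
    fCoeff U 0 = 0 := by
  simp [fCoeff, intervalIntegral.integral_ofReal, havg]

/-- Membership in `H^s(𝕋)` is unaffected by changing finitely many Fourier coefficients. -/
theorem memHs.congr_cofinite {s : ℝ} {c d : FC} (hc : memHs s c)
    (h : d =ᶠ[Filter.cofinite] c) : memHs s d :=
  (summable_congr_cofinite (by filter_upwards [h] with j hj; rw [hj])).2 hc

theorem memHs_expFn (s : ℝ) (j : ℤ) : memHs s (expFn j) := by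
  refine memHs.congr_cofinite (c := 0) (by simp [memHs]) ?_
  filter_upwards [Filter.eventually_cofinite_ne j] with m hm
  simp [expFn, hm]

theorem memHs_two_eig0 {U : ℝ → ℝ} (hU : ContDiff ℝ 2 U)
    (hper : Function.Periodic U (2 * Real.pi)) (ν ε : ℝ) : memHs 2 (eig0 U ν ε) := by
  refine (memHs_two_fCoeff hU hper).congr_cofinite ?_
  filter_upwards [Filter.eventually_cofinite_ne 0] with m hm
  simp [eig0, hm]

theorem Mop_apply (ν ε : ℝ) (U c : FC) (m : ℤ) :
    Mop ν ε U c m = -((ν * ((m : ℝ) ^ 2 + ε ^ 2) : ℝ) : ℂ) * c m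
      + Complex.I / ε * c 0 * ((m : ℂ) ^ 2 * U m) := by
  simp only [Mop, Dop, dd]
  push_cast
  ring

theorem Mop_eig0 {U : ℝ → ℝ} (havg : (∫ y in (0:ℝ)..(2 * Real.pi), U y) = 0)
    (ν : ℝ) {ε : ℝ} (hε : ε ≠ 0) (m : ℤ) :
    Mop ν ε (fCoeff U) (eig0 U ν ε) m = -((ν * ε ^ 2 : ℝ) : ℂ) * eig0 U ν ε m := by
  have hε' : (ε : ℂ) ≠ 0 := by exact_mod_cast hε
  rw [Mop_apply]
  rcases eq_or_ne m 0 with rfl | hm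
  · simp
  · simp only [eig0, hm, if_false, if_true, fCoeff_zero havg]
    push_cast
    field_simp
    linear_combination (-(ν : ℂ) * ε * m ^ 2 * fCoeff U m) * Complex.I_sq

theorem Mop_expFn (ν ε : ℝ) (U : FC) {j : ℤ} (hj : j ≠ 0) (m : ℤ) :
    Mop ν ε U (expFn j) m = -((ν * ((j : ℝ) ^ 2 + ε ^ 2) : ℝ) : ℂ) * expFn j m := by
  rw [Mop_apply]
  rcases eq_or_ne m j with rfl | hm
  · simp [expFn, hj.symm]
  · simp [expFn, hj.symm, hm]

theorem exists_eigenvector_Mop_iff {U : ℝ → ℝ} (hU : ContDiff ℝ 2 U)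
    (hper : Function.Periodic U (2 * Real.pi))
    (havg : (∫ y in (0:ℝ)..(2 * Real.pi), U y) = 0)
    {ν ε : ℝ} (hν : 0 < ν) (hε : ε ≠ 0) (z : ℂ) :
    (∃ f : FC, f ≠ 0 ∧ memHs 2 f ∧ ∀ m, Mop ν ε (fCoeff U) f m = z * f m)
      ↔ ∃ j : ℤ, z = -((ν * ((j : ℝ) ^ 2 + ε ^ 2) : ℝ) : ℂ) := by
  constructor
  · rintro ⟨f, hf, -, h⟩
    by_cases h0 : f 0 = 0
    · obtain ⟨m, hm⟩ := Function.ne_iff.1 hf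
      refine ⟨m, mul_right_cancel₀ hm ?_⟩
      rw [← h m, Mop_apply, h0]
      simp
    · refine ⟨0, mul_right_cancel₀ h0 ?_⟩
      rw [← h 0, Mop_apply]
      simp
  · rintro ⟨j, rfl⟩
    rcases eq_or_ne j 0 with rfl | hj
    · refine ⟨eig0 U ν ε, fun h => ?_, memHs_two_eig0 hU hper ν ε, fun m => ?_⟩
      · have := congrFun h 0
        simp [eig0, fCoeff_zero havg, hε, hν.ne'] at this
      · rw [Mop_eig0 havg ν hε]
        simp
    · refine ⟨expFn j, fun h => ?_, memHs_expFn 2 j, Mop_expFn ν ε _ hj⟩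
      have := congrFun h j
      simp [expFn] at this

theorem exists_solution_Mop_sub {U : ℝ → ℝ} (hU : ContDiff ℝ 2 U)
    (hper : Function.Periodic U (2 * Real.pi)) {ν : ℝ} (ε : ℝ) (hν : 0 < ν) {z : ℂ}
    (hz : ∀ j : ℤ, z ≠ -((ν * ((j : ℝ) ^ 2 + ε ^ 2) : ℝ) : ℂ)) {g : FC} (hg : memL2 g) :
    ∃ f : FC, memHs 2 f ∧ ∀ m, Mop ν ε (fCoeff U) f m - z * f m = g m := by
  let s : FC := fun j => -((ν * ((j : ℝ) ^ 2 + ε ^ 2) : ℝ) : ℂ) - z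
  have hs : ∀ j, s j ≠ 0 := fun j => sub_ne_zero.2 (hz j).symm
  let r : FC := fun j => g j - Complex.I / ε * (g 0 / s 0) * ((j : ℂ) ^ 2 * fCoeff U j)
  have hr : memL2 r := hg.sub ((memL2_sq_mul_fCoeff hU hper).const_mul _)
  refine ⟨fun j => r j / s j, memHs_two_iff.2 (hr.of_isBigO ?_), fun m => ?_⟩
  · refine ((isBigO_symbol hν ε z).mul (Asymptotics.isBigO_refl (fun j => r j / s j) _)).congr_right
      fun j => ?_
    exact mul_div_cancel₀ _ (hs j)
  · have hm : s m * (r m / s m) = r m := mul_div_cancel₀ _ (hs m)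
    have hr0 : r 0 = g 0 := by simp [r]
    rw [Mop_apply, hr0]
    simp only [s, r] at hm ⊢
    linear_combination hm

theorem existsUnique_expansion {U : ℝ → ℝ} (hU : Continuous U)
    (havg : (∫ y in (0:ℝ)..(2 * Real.pi), U y) = 0)
    {ν ε : ℝ} (hν : ν ≠ 0) (hε : ε ≠ 0) {f : FC} (hf : memL2 f) :
    ∃! a : FC, memL2 a ∧
      ∀ m, f m = a 0 * eig0 U ν ε m + (if m = 0 then 0 else a m) := by
  have h0 : eig0 U ν ε 0 ≠ 0 := by simp [eig0, fCoeff_zero havg, hε, hν]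
  have hne : ∀ m ≠ 0, eig0 U ν ε m = fCoeff U m := fun m hm => by simp [eig0, hm]
  refine ⟨fun m => if m = 0 then f 0 / eig0 U ν ε 0
    else f m - f 0 / eig0 U ν ε 0 * fCoeff U m, ⟨?_, fun m => ?_⟩, ?_⟩
  · refine (hf.sub ((memL2_fCoeff hU).const_mul (f 0 / eig0 U ν ε 0))).of_isBigO
      (Filter.EventuallyEq.isBigO ?_)
    filter_upwards [Filter.eventually_cofinite_ne 0] with m hm
    simp [hm]
  · rcases eq_or_ne m 0 with rfl | hm
    · simp [h0]
    · simp [hm, hne m hm]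
  · rintro b ⟨-, hb⟩
    have hb0 : b 0 = f 0 / eig0 U ν ε 0 := by
      rw [eq_div_iff h0]
      simpa using (hb 0).symm
    funext m
    rcases eq_or_ne m 0 with rfl | hm
    · simpa using hb0
    · have := hb m
      simp only [hm, if_false, hne m hm, hb0] at this ⊢
      linear_combination -this

/-- Lemma 2.3: the spectrum of `ℳ_{ν,ε}` on `L²(𝕋)` is
`{-ν(j² + ε²)}_{j ∈ ℤ}`, and the eigenfunctions `{U - iεν} ∪ {e^{±ijy}}_{j ∈ ℕ}`
(associated with `-νε²` resp. `-ν(j² + ε²)`) form a basis of `L²(𝕋)`. -/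
theorem statement3 (U : ℝ → ℝ) (hU : ContDiff ℝ 2 U)
    (hper : Function.Periodic U (2 * Real.pi))
    (havg : (∫ y in (0:ℝ)..(2 * Real.pi), U y) = 0)
    (ν ε : ℝ) (hν : 0 < ν) (hε : ε ≠ 0) :
    -- eigenvalue equations:
    (∀ m, Mop ν ε (fCoeff U) (eig0 U ν ε) m
        = -((ν * ε ^ 2 : ℝ) : ℂ) * eig0 U ν ε m) ∧
    (∀ j : ℤ, j ≠ 0 → ∀ m, Mop ν ε (fCoeff U) (expFn j) m
        = -((ν * ((j : ℝ) ^ 2 + ε ^ 2) : ℝ) : ℂ) * expFn j m) ∧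
    -- `σ_{L²}(ℳ_{ν,ε}) = ν σ_{L²}(𝒟_ε) = {-ν(j²+ε²)}`: these are exactly the eigenvalues,
    (∀ z : ℂ, (∃ f : FC, f ≠ 0 ∧ memHs 2 f ∧ ∀ m, Mop ν ε (fCoeff U) f m = z * f m)
        ↔ ∃ j : ℤ, z = -((ν * ((j : ℝ) ^ 2 + ε ^ 2) : ℝ) : ℂ)) ∧
    -- and every other `z` belongs to the resolvent set,
    (∀ z : ℂ, (∀ j : ℤ, z ≠ -((ν * ((j : ℝ) ^ 2 + ε ^ 2) : ℝ) : ℂ)) →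
        ∀ g : FC, memL2 g →
          ∃ f : FC, memHs 2 f ∧ ∀ m, Mop ν ε (fCoeff U) f m - z * f m = g m) ∧
    -- basis property: each `f ∈ L²` has a unique expansion along the eigenfunctions.
    (∀ f : FC, memL2 f →
        ∃! a : FC, memL2 a ∧
          ∀ m, f m = a 0 * eig0 U ν ε m + (if m = 0 then 0 else a m)) := by
  exact ⟨Mop_eig0 havg ν hε, fun _ => Mop_expFn ν ε _,
    exists_eigenvector_Mop_iff hU hper havg hν hε,
    fun _ hz _ => exists_solution_Mop_sub hU hper ε hν hz,
    fun _ => existsUnique_expansion hU.continuous havg hν.ne' hε⟩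

end
end

section
/- Let m, s ≥ 0, a, Q ∈ H^s₀(𝕋) and P ∈ H^{s+m}₀(𝕋). Then: (i) the multiplication operator M_a : u ↦ au belongs to 𝓜^s with |M_a|_s ≤ C(s)‖a‖_s; (ii) the rank-one operator 𝒜 := (∂_y^m P)Q^⊤, i.e. u ↦ ⟨u, Q⟩_{L²}·∂_y^m P, belongs to 𝓜^s with |(∂_y^m P)Q^⊤|_s ≤ C(s)‖P‖_{s+m}‖Q‖_s. -/
open Complex
open scoped ComplexConjugate

noncomputable section

/-- nonzero Fourier modes -/
abbrev Nz : Type := {j : ℤ // j ≠ 0}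

/-- zero-average functions, through their nonzero Fourier modes -/
abbrev V0 : Type := Nz → ℂ

def pz (a : ℕ+) : Nz := ⟨((a : ℕ) : ℤ), by exact_mod_cast a.ne_zero⟩

def nz (a : ℕ+) : Nz := ⟨-((a : ℕ) : ℤ), neg_ne_zero.mpr (by exact_mod_cast a.ne_zero)⟩

/-- matrix element `𝒯_j^{j'} = ⟨𝒯[e^{ij'y}], e^{ijy}⟩_{L²}` of an operator on `L²₀(𝕋)` -/
def matEl (T : V0 → V0) (j j' : Nz) : ℂ :=
  (2 * Real.pi) * T (fun m => if m = j' then 1 else 0) j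

/-- squared Hilbert–Schmidt norm `‖Π_a 𝒯 Π_b‖²_{2×2}` of the `(a,b)` block -/
def blockHSsq (T : V0 → V0) (a b : ℕ+) : ℝ :=
  ‖matEl T (pz a) (pz b)‖ ^ 2 + ‖matEl T (pz a) (nz b)‖ ^ 2
    + ‖matEl T (nz a) (pz b)‖ ^ 2 + ‖matEl T (nz a) (nz b)‖ ^ 2

def colSq (s : ℝ) (T : V0 → V0) (b : ℕ+) : ℝ :=
  ∑' a : ℕ+, (1 + (((a : ℕ) : ℝ) - ((b : ℕ) : ℝ)) ^ 2) ^ s * blockHSsq T a b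

/-- membership in the class `𝓜^s` (finite block decay norm) -/
def MemM (s : ℝ) (T : V0 → V0) : Prop :=
  (∀ b : ℕ+, Summable fun a : ℕ+ =>
    (1 + (((a : ℕ) : ℝ) - ((b : ℕ) : ℝ)) ^ 2) ^ s * blockHSsq T a b) ∧
  BddAbove (Set.range fun b : ℕ+ => colSq s T b)

/-- the block decay norm `|𝒯|_s` -/
def mNorm (s : ℝ) (T : V0 → V0) : ℝ := ⨆ b : ℕ+, Real.sqrt (colSq s T b)

/-- the multiplication operator `M_a : u ↦ au` on zero-average functions -/
def Ma (a : FC) : V0 → V0 :=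
  fun u j => ∑' k : Nz, a ((j : ℤ) - (k : ℤ)) * u k

/-- the rank-one operator `(∂_y^m P) Q^⊤ : u ↦ ⟨u, Q⟩_{L²} ∂_y^m P` -/
def rankOne (m : ℕ) (P Q : FC) : V0 → V0 :=
  fun u j => ((2 * Real.pi) * ∑' k : Nz, u k * conj (Q (k : ℤ)))
    * ((Complex.I * ((j : ℤ) : ℂ)) ^ m * P (j : ℤ))

/-- The `j`-th summand of the squared `H^s` norm. -/
def sobolevTerm (s : ℝ) (c : FC) (j : ℤ) : ℝ := (1 + (j : ℝ) ^ 2) ^ s * ‖c j‖ ^ 2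

lemma sobolevTerm_nonneg (s : ℝ) (c : FC) (j : ℤ) : 0 ≤ sobolevTerm s c j := by
  unfold sobolevTerm; positivity

lemma HsNorm_sq (s : ℝ) (c : FC) :
    HsNorm s c ^ 2 = 2 * Real.pi * ∑' j : ℤ, sobolevTerm s c j :=
  Real.sq_sqrt (mul_nonneg (by positivity) (tsum_nonneg (sobolevTerm_nonneg s c)))

lemma HsNorm_nonneg (s : ℝ) (c : FC) : 0 ≤ HsNorm s c := Real.sqrt_nonneg _

lemma blockHSsq_nonneg (T : V0 → V0) (a b : ℕ+) : 0 ≤ blockHSsq T a b := by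
  unfold blockHSsq; positivity

lemma matEl_Ma (a : FC) (j j' : Nz) : matEl (Ma a) j j' = 2 * Real.pi * a ((j : ℤ) - j') := by
  simp [matEl, Ma]

lemma matEl_rankOne (m : ℕ) (P Q : FC) (j j' : Nz) :
    matEl (rankOne m P Q) j j' =
      (2 * Real.pi) ^ 2 * conj (Q j') * ((I * ((j : ℤ) : ℂ)) ^ m * P j) := by
  simp [matEl, rankOne]
  ring

lemma memM_and_mNorm_le {s : ℝ} {T : V0 → V0} {D : ℝ} (hD : 0 ≤ D)
    (h : ∀ b : ℕ+, (Summable fun a : ℕ+ =>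
      (1 + (((a : ℕ) : ℝ) - ((b : ℕ) : ℝ)) ^ 2) ^ s * blockHSsq T a b) ∧ colSq s T b ≤ D ^ 2) :
    MemM s T ∧ mNorm s T ≤ D :=
  ⟨⟨fun b => (h b).1, D ^ 2, by rintro _ ⟨b, rfl⟩; exact (h b).2⟩,
    ciSup_le fun b => Real.sqrt_le_iff.2 ⟨hD, (h b).2⟩⟩

/-- A nonnegative family dominated by four injective reindexings of a summable family. -/
lemma summable_and_tsum_le_of_injective_four {ι κ : Type*} {f : ι → ℝ} {g : κ → ℝ} {K : ℝ}
    (hf : ∀ a, 0 ≤ f a) (hg : ∀ j, 0 ≤ g j) (hgs : Summable g) (hK : 0 ≤ K)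
    {e₁ e₂ e₃ e₄ : ι → κ} (h₁ : e₁.Injective) (h₂ : e₂.Injective) (h₃ : e₃.Injective)
    (h₄ : e₄.Injective)
    (hfg : ∀ a, f a ≤ K * (g (e₁ a) + g (e₂ a) + g (e₃ a) + g (e₄ a))) :
    Summable f ∧ ∑' a, f a ≤ 4 * K * ∑' j, g j := by
  have key : ∀ {e : ι → κ}, e.Injective →
      Summable (fun a => g (e a)) ∧ ∑' a, g (e a) ≤ ∑' j, g j := fun he =>
    ⟨hgs.comp_injective he, (hgs.comp_injective he).tsum_le_tsum_of_inj _ he (fun c _ => hg c)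
      (fun _ => le_rfl) hgs⟩
  have hs := ((((key h₁).1.add (key h₂).1).add (key h₃).1).add (key h₄).1)
  have hsf : Summable f := .of_nonneg_of_le hf hfg (hs.mul_left K)
  refine ⟨hsf, (hsf.tsum_le_tsum hfg (hs.mul_left K)).trans ?_⟩
  rw [tsum_mul_left, (((key h₁).1.add (key h₂).1).add (key h₃).1).tsum_add (key h₄).1,
    ((key h₁).1.add (key h₂).1).tsum_add (key h₃).1, (key h₁).1.tsum_add (key h₂).1]
  nlinarith [(key h₁).2, (key h₂).2, (key h₃).2, (key h₄).2]

lemma weight_mul_block_nonneg (s : ℝ) (T : V0 → V0) (a b : ℕ+) :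
    0 ≤ (1 + (((a : ℕ) : ℝ) - ((b : ℕ) : ℝ)) ^ 2) ^ s * blockHSsq T a b :=
  mul_nonneg (by positivity) (blockHSsq_nonneg T a b)

lemma Ma_memM_and_mNorm_le {s : ℝ} (hs : 0 ≤ s) {c : FC} (hc : memHs s c) :
    MemM s (Ma c) ∧ mNorm s (Ma c) ≤ 8 * Real.pi * HsNorm s c := by
  refine memM_and_mNorm_le (mul_nonneg (by positivity) (HsNorm_nonneg s c)) fun b => ?_
  have inj : ∀ x : ℤ, Function.Injective (fun a : ℕ+ => ((a : ℕ) : ℤ) - x) ∧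
      Function.Injective (fun a : ℕ+ => -((a : ℕ) : ℤ) - x) := fun x =>
    ⟨fun a a' h => PNat.eq (by simpa using h), fun a a' h => PNat.eq (by simpa using h)⟩
  have bound : ∀ a : ℕ+,
      (1 + (((a : ℕ) : ℝ) - ((b : ℕ) : ℝ)) ^ 2) ^ s * blockHSsq (Ma c) a b ≤
        (2 * Real.pi) ^ 2 *
          (sobolevTerm s c (((a : ℕ) : ℤ) - ((b : ℕ) : ℤ))
          + sobolevTerm s c (((a : ℕ) : ℤ) - -((b : ℕ) : ℤ))
          + sobolevTerm s c (-((a : ℕ) : ℤ) - ((b : ℕ) : ℤ))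
          + sobolevTerm s c (-((a : ℕ) : ℤ) - -((b : ℕ) : ℤ))) := by
    intro a
    have ha : (0 : ℝ) ≤ (a : ℕ) := Nat.cast_nonneg _
    have hb : (0 : ℝ) ≤ (b : ℕ) := Nat.cast_nonneg _
    have term : ∀ n : ℤ, (((a : ℕ) : ℝ) - ((b : ℕ) : ℝ)) ^ 2 ≤ (n : ℝ) ^ 2 →
        (1 + (((a : ℕ) : ℝ) - ((b : ℕ) : ℝ)) ^ 2) ^ s * ‖2 * (Real.pi : ℂ) * c n‖ ^ 2 ≤
          (2 * Real.pi) ^ 2 * sobolevTerm s c n := by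
      intro n hn
      have hw : (1 + (((a : ℕ) : ℝ) - ((b : ℕ) : ℝ)) ^ 2) ^ s ≤ (1 + (n : ℝ) ^ 2) ^ s := by
        gcongr
      have hnorm : ‖2 * (Real.pi : ℂ) * c n‖ ^ 2 = (2 * Real.pi) ^ 2 * ‖c n‖ ^ 2 := by
        simp [abs_of_pos Real.pi_pos, mul_pow]
      rw [hnorm, sobolevTerm, mul_left_comm]
      gcongr
    simp only [blockHSsq, matEl_Ma, pz, nz, mul_add]
    refine add_le_add (add_le_add (add_le_add (term _ ?_) (term _ ?_)) (term _ ?_)) (term _ ?_) <;>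
      push_cast <;> nlinarith [mul_nonneg ha hb]
  obtain ⟨hsum, hle⟩ := summable_and_tsum_le_of_injective_four
    (weight_mul_block_nonneg s (Ma c) · b) (sobolevTerm_nonneg s c) hc (by positivity)
    (inj _).1 (inj _).1 (inj _).2 (inj _).2 bound
  refine ⟨hsum, hle.trans ?_⟩
  have h0 : 0 ≤ ∑' j, sobolevTerm s c j := tsum_nonneg (sobolevTerm_nonneg s c)
  rw [mul_pow _ (HsNorm s c), HsNorm_sq]
  have hpi := Real.pi_gt_three
  have : (16 * Real.pi ^ 2) * ∑' j, sobolevTerm s c j ≤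
      (128 * Real.pi ^ 3) * ∑' j, sobolevTerm s c j := by
    gcongr
    · norm_num
    · linarith
    · norm_num
  linarith

lemma rankOne_memM_and_mNorm_le {m : ℕ} {s : ℝ} (hs : 0 ≤ s) {P Q : FC}
    (hP : memHs (s + m) P) (hQ : memHs s Q) :
    MemM s (rankOne m P Q) ∧
      mNorm s (rankOne m P Q) ≤ 8 * Real.pi * HsNorm (s + m) P * HsNorm s Q := by
  refine memM_and_mNorm_le (mul_nonneg (mul_nonneg (by positivity) (HsNorm_nonneg _ P))
    (HsNorm_nonneg s Q)) fun b => ?_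
  have hP0 := sobolevTerm_nonneg (s + m) P
  have hQ0 : 0 ≤ ∑' j, sobolevTerm s Q j := tsum_nonneg (sobolevTerm_nonneg s Q)
  have inj : Function.Injective (fun a : ℕ+ => ((a : ℕ) : ℤ)) ∧
      Function.Injective (fun a : ℕ+ => -((a : ℕ) : ℤ)) :=
    ⟨fun a a' h => PNat.eq (by simpa using h), fun a a' h => PNat.eq (by simpa using h)⟩
  have bound : ∀ a : ℕ+,
      (1 + (((a : ℕ) : ℝ) - ((b : ℕ) : ℝ)) ^ 2) ^ s * blockHSsq (rankOne m P Q) a b ≤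
        ((2 * Real.pi) ^ 4 * ∑' j, sobolevTerm s Q j) *
          (sobolevTerm (s + m) P ((a : ℕ) : ℤ) + sobolevTerm (s + m) P ((a : ℕ) : ℤ)
          + sobolevTerm (s + m) P (-((a : ℕ) : ℤ)) + sobolevTerm (s + m) P (-((a : ℕ) : ℤ))) := by
    intro a
    have term : ∀ n k : ℤ, (n : ℝ) ^ 2 = ((a : ℕ) : ℝ) ^ 2 → (k : ℝ) ^ 2 = ((b : ℕ) : ℝ) ^ 2 →
        (1 + (((a : ℕ) : ℝ) - ((b : ℕ) : ℝ)) ^ 2) ^ s *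
          ‖(2 * (Real.pi : ℂ)) ^ 2 * conj (Q k) * ((I * (n : ℂ)) ^ m * P n)‖ ^ 2 ≤
          ((2 * Real.pi) ^ 4 * ∑' j, sobolevTerm s Q j) * sobolevTerm (s + m) P n := by
      intro n k hn hk
      have hw : (1 + (((a : ℕ) : ℝ) - ((b : ℕ) : ℝ)) ^ 2) ^ s ≤
          (1 + (n : ℝ) ^ 2) ^ s * (1 + (k : ℝ) ^ 2) ^ s := by
        rw [← Real.mul_rpow (by positivity) (by positivity), hn, hk]
        gcongr
        have : (0 : ℝ) ≤ (a : ℕ) * (b : ℕ) := by positivity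
        nlinarith [mul_nonneg (sq_nonneg ((a : ℕ) : ℝ)) (sq_nonneg ((b : ℕ) : ℝ))]
      have hnorm : ‖(2 * (Real.pi : ℂ)) ^ 2 * conj (Q k) * ((I * (n : ℂ)) ^ m * P n)‖ ^ 2 =
          (2 * Real.pi) ^ 4 * ‖Q k‖ ^ 2 * (((n : ℝ) ^ 2) ^ m * ‖P n‖ ^ 2) := by
        simp only [norm_mul, norm_pow, norm_I, Complex.norm_real, Complex.norm_intCast,
          RCLike.norm_conj, Complex.norm_ofNat, Real.norm_eq_abs, abs_of_pos Real.pi_pos, one_mul]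
        rw [← sq_abs (n : ℝ)]
        ring
      have hm : ((n : ℝ) ^ 2) ^ m ≤ (1 + (n : ℝ) ^ 2) ^ m := by
        gcongr; linarith
      have hPn : sobolevTerm (s + m) P n =
          (1 + (n : ℝ) ^ 2) ^ s * (1 + (n : ℝ) ^ 2) ^ m * ‖P n‖ ^ 2 := by
        rw [sobolevTerm, Real.rpow_add (by positivity), Real.rpow_natCast]
      have hQk : sobolevTerm s Q k ≤ ∑' j, sobolevTerm s Q j :=
        hQ.le_tsum k fun j _ => sobolevTerm_nonneg s Q j
      rw [hnorm]
      calc _ ≤ ((1 + (n : ℝ) ^ 2) ^ s * (1 + (k : ℝ) ^ 2) ^ s) *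
            ((2 * Real.pi) ^ 4 * ‖Q k‖ ^ 2 * ((1 + (n : ℝ) ^ 2) ^ m * ‖P n‖ ^ 2)) := by
            gcongr
        _ = ((2 * Real.pi) ^ 4 * sobolevTerm s Q k) * sobolevTerm (s + m) P n := by
            rw [hPn, sobolevTerm]; ring
        _ ≤ _ := by
            gcongr
            exact hP0 n
    simp only [blockHSsq, matEl_rankOne, pz, nz, mul_add]
    exact add_le_add (add_le_add (add_le_add (term _ _ (by simp) (by simp))
      (term _ _ (by simp) (by simp))) (term _ _ (by simp) (by simp)))
      (term _ _ (by simp) (by simp))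
  obtain ⟨hsum, hle⟩ := summable_and_tsum_le_of_injective_four
    (weight_mul_block_nonneg s (rankOne m P Q) · b) hP0 hP (by positivity)
    inj.1 inj.1 inj.2 inj.2 bound
  refine ⟨hsum, hle.trans ?_⟩
  rw [mul_pow _ (HsNorm s Q), mul_pow _ (HsNorm (s + m) P), HsNorm_sq, HsNorm_sq]
  have : 0 ≤ Real.pi ^ 4 * (∑' j, sobolevTerm (s + m) P j) * ∑' j, sobolevTerm s Q j :=
    mul_nonneg (mul_nonneg (by positivity) (tsum_nonneg hP0)) hQ0
  linarith

/-- Lemma 3.7: multiplication operators and rank-one operators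
belong to `𝓜^s`, with `|M_a|_s ≤ C‖a‖_s` and `|(∂_y^m P)Q^⊤|_s ≤ C‖P‖_{s+m}‖Q‖_s`. -/
theorem statement16 (m : ℕ) (s : ℝ) (hs : 0 ≤ s) :
    ∃ C : ℝ, 0 < C ∧
      ∀ a Q P : FC, a 0 = 0 → Q 0 = 0 → P 0 = 0 →
        memHs s a → memHs s Q → memHs (s + m) P →
        (MemM s (Ma a) ∧ mNorm s (Ma a) ≤ C * HsNorm s a) ∧
        (MemM s (rankOne m P Q) ∧
          mNorm s (rankOne m P Q) ≤ C * HsNorm (s + m) P * HsNorm s Q) := by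
  refine ⟨8 * Real.pi, by positivity, fun a Q P _ _ _ ha hQ hP => ?_⟩
  exact ⟨Ma_memM_and_mNorm_le hs ha, rankOne_memM_and_mNorm_le hs hP hQ⟩

end
end
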